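/- Let G be an infinite graph such that for every finite vertex set F ⊆ V(G) and every vertex v ∈ V(G), at most one connected component C of G − F has the property that the set C_v ∩ C contains a non-dominated ray (where C_v is the edge-equivalence class of v, and 'contains a ray' means some ray passes through infinitely many vertices of the set). Then any two rays of G that are edge-equivalent and both non-dominated are vertex-equivalent. -/

import Mathlib

open SimpleGraph

variable {V : Type*}

/-- A ray in `G`: a one-way infinite path. -/
structure GraphRay (G : SimpleGraph V) where
  f : ℕ → V
  inj : Function.Injective f
  adj : ∀ n, G.Adj (f n) (f (n + 1))

/-- Rays `r` and `s` are edge-equivalent: for every finite edge set `F`,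
they have tails in the same connected component of `G - F`. -/
def RayEdgeEquiv (G : SimpleGraph V) (r s : GraphRay G) : Prop :=
  ∀ F : Finset (Sym2 V), ∃ N, ∀ m ≥ N, ∀ n ≥ N,
    (G.deleteEdges ↑F).Reachable (r.f m) (s.f n)

/-- Rays `r` and `s` are vertex-equivalent: for every finite vertex set `X`,
they have tails in the same connected component of `G - X`. -/
def RayVertexEquiv (G : SimpleGraph V) (r s : GraphRay G) : Prop :=
  ∀ X : Finset V, ∃ N, ∀ m ≥ N, ∀ n ≥ N,
    ∃ (hm : r.f m ∈ ((↑X : Set V)ᶜ)) (hn : s.f n ∈ ((↑X : Set V)ᶜ)),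
      (G.induce ((↑X : Set V)ᶜ)).Reachable ⟨r.f m, hm⟩ ⟨s.f n, hn⟩

/-- Vertices `u` and `v` are edge-equivalent: for every finite edge set `F`,
they lie in the same connected component of `G - F`. -/
def VertexEdgeEquiv (G : SimpleGraph V) (u v : V) : Prop :=
  ∀ F : Finset (Sym2 V), (G.deleteEdges ↑F).Reachable u v

/-- The edge-equivalence class of a vertex `v`. -/
def edgeClass (G : SimpleGraph V) (v : V) : Set V := {u | VertexEdgeEquiv G v u}

/-- `v` edge-dominates the ray `r`: for every finite edge set `F`, `r` has a tail
in the same connected component of `G - F` as `v`. -/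
def EdgeDominates (G : SimpleGraph V) (v : V) (r : GraphRay G) : Prop :=
  ∀ F : Finset (Sym2 V), ∃ N, ∀ n ≥ N, (G.deleteEdges ↑F).Reachable v (r.f n)

/-- `v` dominates the ray `r`: there are infinitely many `v`–`r` paths,
pairwise disjoint except at `v`. -/
def Dominates (G : SimpleGraph V) (v : V) (r : GraphRay G) : Prop :=
  ∃ k : ℕ → ℕ, StrictMono k ∧
    ∃ P : ∀ n, G.Walk v (r.f (k n)),
      (∀ n, (P n).IsPath) ∧
      ∀ m n, m ≠ n → ∀ x, x ∈ (P m).support → x ∈ (P n).support → x = v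

/-- A set `S` of vertices contains the ray `t`: `t` passes through infinitely
many vertices of `S`. -/
def SetContainsRay (G : SimpleGraph V) (S : Set V) (t : GraphRay G) : Prop :=
  {n : ℕ | t.f n ∈ S}.Infinite

/-- The vertices outside `D` with a neighbour in `D`. -/
def outerBoundary (G : SimpleGraph V) (D : Set V) : Set V := {w | w ∉ D ∧ ∃ z ∈ D, G.Adj w z}

/-- `D` has finite outer boundary and contains a tail of `r`. -/
def IsRayRegion (G : SimpleGraph V) (r : GraphRay G) (D : Set V) : Prop :=
  (outerBoundary G D).Finite ∧ ∃ N, ∀ n ≥ N, r.f n ∈ D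

theorem exists_mem_support_outerBoundary {G H : SimpleGraph V} (hle : H ≤ G) {D : Set V} {a b : V}
    (p : H.Walk a b) (ha : a ∉ D) (hb : b ∈ D) : ∃ z ∈ p.support, z ∈ outerBoundary G D := by
  obtain ⟨d, hd, h1, h2⟩ := p.exists_boundary_dart Dᶜ ha (by simpa using hb)
  exact ⟨d.fst, p.dart_fst_mem_support_of_mem_darts hd, h1, d.snd, by simpa using h2, hle d.adj⟩

theorem union_outerBoundary_mono {G : SimpleGraph V} {D E : Set V} (h : D ⊆ E) :
    D ∪ outerBoundary G D ⊆ E ∪ outerBoundary G E := by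
  rintro w (hw | ⟨-, z, hz, hwz⟩)
  · exact Or.inl (h hw)
  · by_cases hE : w ∈ E
    · exact Or.inl hE
    · exact Or.inr ⟨hE, z, h hz, hwz⟩

theorem GraphRay.exists_forall_notMem {G : SimpleGraph V} (r : GraphRay G) {Z : Set V}
    (hZ : Z.Finite) : ∃ N, ∀ n ≥ N, r.f n ∉ Z := by
  obtain ⟨b, hb⟩ := (hZ.preimage r.inj.injOn).bddAbove
  exact ⟨b + 1, fun n hn hmem => absurd (hb hmem) (by omega)⟩

theorem IsRayRegion.inter {G : SimpleGraph V} {r : GraphRay G} {D E : Set V}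
    (hD : IsRayRegion G r D) (hE : IsRayRegion G r E) : IsRayRegion G r (D ∩ E) := by
  obtain ⟨fD, N, hN⟩ := hD
  obtain ⟨fE, M, hM⟩ := hE
  refine ⟨(fD.union fE).subset ?_, max N M, fun n hn =>
    ⟨hN n (le_trans (le_max_left _ _) hn), hM n (le_trans (le_max_right _ _) hn)⟩⟩
  rintro w ⟨hw, z, hz, hwz⟩
  by_cases h : w ∈ D
  · exact Or.inr ⟨fun h' => hw ⟨h, h'⟩, z, hz.2, hwz⟩
  · exact Or.inl ⟨h, z, hz.1, hwz⟩

theorem IsRayRegion.biInter {G : SimpleGraph V} {r : GraphRay G} {ι : Type*} (s : Finset ι)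
    (D : ι → Set V) (hD : ∀ i ∈ s, IsRayRegion G r (D i)) :
    IsRayRegion G r (⋂ i ∈ s, D i) := by
  classical
  induction s using Finset.induction_on with
  | empty => exact ⟨by simp [outerBoundary], 0, by simp⟩
  | insert a s ha ih =>
    rw [Finset.set_biInter_insert]
    exact (hD a (by simp)).inter (ih fun i hi => hD i (by simp [hi]))

theorem exists_path_avoiding {G : SimpleGraph V} {r : GraphRay G} {v : V}
    (hv : ∀ D, IsRayRegion G r D → v ∈ D ∪ outerBoundary G D) {Z : Set V} (hZ : Z.Finite)
    (hvZ : v ∉ Z) (N : ℕ) :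
    ∃ n ≥ N, ∃ p : G.Walk v (r.f n), p.IsPath ∧ ∀ z ∈ p.support, z ∉ Z := by
  classical
  by_contra! hcon
  set K : Set V := {w | ∃ p : G.Walk v w, ∀ z ∈ p.support, z ∉ Z} with hK
  have hvK : v ∈ K := ⟨.nil, by simpa using hvZ⟩
  have hKZ : ∀ a ∈ K, ∀ b, G.Adj a b → b ∉ Z → b ∈ K := by
    rintro a ⟨p, hp⟩ b hab hb
    refine ⟨p.concat hab, fun z hz => ?_⟩
    rw [Walk.support_concat] at hz
    simp only [List.mem_append, List.mem_singleton] at hz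
    rcases hz with hz | rfl
    exacts [hp z hz, hb]
  have hbd : ∀ w ∈ outerBoundary G (K ∪ Z)ᶜ, w ∈ Z ∧ w ∉ K := by
    rintro w ⟨hw, z, hz, hwz⟩
    simp only [Set.mem_compl_iff, Set.mem_union, not_or, not_and, not_not] at hw hz
    have : w ∉ K := fun h => hz.1 (hKZ w h z hwz hz.2)
    exact ⟨hw this, this⟩
  obtain ⟨M, hM⟩ := r.exists_forall_notMem hZ
  have hreg : IsRayRegion G r (K ∪ Z)ᶜ := by
    refine ⟨hZ.subset fun w hw => (hbd w hw).1, max N M, fun n hn => ?_⟩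
    rintro (⟨p, hp⟩ | h)
    · obtain ⟨z, hz, hz'⟩ := hcon n (le_trans (le_max_left _ _) hn) p.bypass p.bypass_isPath
      exact hp z (p.support_bypass_subset_support hz) hz'
    · exact hM n (le_trans (le_max_right _ _) hn) h
  rcases hv _ hreg with h | h
  · exact h (Or.inl hvK)
  · exact (hbd v h).2 hvK

theorem dominates_of_forall_region {G : SimpleGraph V} {r : GraphRay G} {v : V}
    (hv : ∀ D, IsRayRegion G r D → v ∈ D ∪ outerBoundary G D) : Dominates G v r := by
  obtain ⟨f, hf, hrel⟩ := exists_seq_of_forall_finset_exists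
    (fun a : Σ n, G.Walk v (r.f n) => a.2.IsPath)
    (fun a b => a.1 < b.1 ∧ ∀ x ∈ a.2.support, x ∈ b.2.support → x = v) (by
      intro s _
      have hfin : (⋃ a ∈ s, {x | x ∈ a.2.support} \ {v}).Finite :=
        s.finite_toSet.biUnion fun a _ => (List.finite_toSet _).subset Set.sdiff_subset
      obtain ⟨n, hn, p, hp, hav⟩ := exists_path_avoiding hv hfin (by simp) (s.sup (fun a => a.1) + 1)
      refine ⟨⟨n, p⟩, hp, fun a ha => ⟨?_, fun x hx hxp => ?_⟩⟩
      · have := Finset.le_sup (f := fun a : Σ n, G.Walk v (r.f n) => a.1) ha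
        simp only at this ⊢
        omega
      · by_contra hne
        exact hav x hxp (Set.mem_biUnion (Finset.mem_coe.2 ha) ⟨hx, hne⟩))
  refine ⟨fun n => (f n).1, fun m n hmn => (hrel m n hmn).1, fun n => (f n).2, hf, ?_⟩
  intro m n hmn x hm hn
  rcases lt_or_gt_of_ne hmn with h | h
  · exact (hrel m n h).2 x hm hn
  · exact (hrel n m h).2 x hn hm

theorem exists_region_disjoint {G : SimpleGraph V} {r : GraphRay G} (hr : ¬ ∃ w, Dominates G w r)
    {A : Set V} (hA : A.Finite) :
    ∃ D, IsRayRegion G r D ∧ ∀ a ∈ A, a ∉ D ∪ outerBoundary G D := by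
  have key : ∀ v, ∃ D, IsRayRegion G r D ∧ v ∉ D ∪ outerBoundary G D := by
    intro v
    by_contra! hcon
    exact hr ⟨v, dominates_of_forall_region hcon⟩
  choose D hD hvD using key
  refine ⟨⋂ v ∈ hA.toFinset, D v, IsRayRegion.biInter _ _ fun i _ => hD i, fun a ha hmem => ?_⟩
  exact hvD a (union_outerBoundary_mono
    (Set.biInter_subset_of_mem (hA.mem_toFinset.2 ha)) hmem)

theorem exists_edges_separating_edgeClass (G : SimpleGraph V) (x : V) {Z : Set V} (hZ : Z.Finite) :
    ∃ F : Finset (Sym2 V), ∀ z ∈ Z, (G.deleteEdges ↑F).Reachable x z → z ∈ edgeClass G x := by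
  classical
  have key : ∀ z, ∃ F : Finset (Sym2 V), (G.deleteEdges ↑F).Reachable x z → z ∈ edgeClass G x := by
    intro z
    by_contra! hcon
    exact (hcon ∅).2 fun F => (hcon F).1
  choose F hF using key
  refine ⟨hZ.toFinset.biUnion F, fun z hz hreach => hF z (hreach.mono ?_)⟩
  refine deleteEdges_anti ?_
  exact_mod_cast Finset.subset_biUnion_of_mem F (hZ.mem_toFinset.2 hz)

/-- Nested regions around the end of `r`, with walks from `x` into them that cross their
boundaries inside the edge-class of `x`. -/
theorem exists_nested_regions {G : SimpleGraph V} {r : GraphRay G} (hr : ¬ ∃ w, Dominates G w r)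
    {x : V} (hx : EdgeDominates G x r) {C : Set V} (hC : IsRayRegion G r C) :
    ∃ (D : ℕ → Set V) (y : ℕ → V) (p : ∀ n, G.Walk x (y n)),
      (∀ n, (outerBoundary G (D n)).Finite) ∧ (∀ n, D n ∪ outerBoundary G (D n) ⊆ C) ∧
      (∀ n, x ∉ D n ∪ outerBoundary G (D n)) ∧ (∀ n, y n ∈ D n) ∧
      (∀ m n, m < n → D n ∪ outerBoundary G (D n) ⊆ D m) ∧
      ∀ m n, ∀ z ∈ (p n).support, z ∈ outerBoundary G (D m) → z ∈ edgeClass G x := by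
  classical
  obtain ⟨f, hf, hrel⟩ := exists_seq_of_forall_finset_exists
    (fun a : Set V × Σ y, G.Walk x y => IsRayRegion G r a.1 ∧ a.1 ∪ outerBoundary G a.1 ⊆ C ∧
      x ∉ a.1 ∪ outerBoundary G a.1 ∧ a.2.1 ∈ a.1 ∧
      ∀ z ∈ a.2.2.support, z ∈ outerBoundary G a.1 → z ∈ edgeClass G x)
    (fun a b => b.1 ∪ outerBoundary G b.1 ⊆ a.1 ∧
      (∀ z ∈ a.2.2.support, z ∉ outerBoundary G b.1) ∧
      ∀ z ∈ b.2.2.support, z ∈ outerBoundary G a.1 → z ∈ edgeClass G x) (by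
      intro s hs
      have hbfin : (⋃ a ∈ s, outerBoundary G a.1).Finite :=
        s.finite_toSet.biUnion fun a ha => (hs a ha).1.1
      have hsfin : (⋃ a ∈ s, {z | z ∈ a.2.2.support}).Finite :=
        s.finite_toSet.biUnion fun a _ => List.finite_toSet _
      obtain ⟨E, hE, hEA⟩ := exists_region_disjoint hr
        (((hbfin.union hsfin).union hC.1).union (Set.finite_singleton x))
      set D := (C ∩ ⋂ a ∈ s, a.1) ∩ E with hDdef
      have hD : IsRayRegion G r D := (hC.inter (.biInter s _ fun a ha => (hs a ha).1)).inter hE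
      have hDA : ∀ z ∈ D ∪ outerBoundary G D, z ∈ E ∪ outerBoundary G E := fun z hz =>
        union_outerBoundary_mono Set.inter_subset_right hz
      obtain ⟨F, hF⟩ := exists_edges_separating_edgeClass G x (hbfin.union hD.1)
      obtain ⟨N, hN⟩ := hx F
      obtain ⟨M, hM⟩ := hD.2
      obtain ⟨q⟩ := hN (max N M) (le_max_left _ _)
      have hle : G.deleteEdges (↑F : Set (Sym2 V)) ≤ G := deleteEdges_le _
      have hq : ∀ z ∈ (q.mapLe hle).support,
          z ∈ (⋃ a ∈ s, outerBoundary G a.1) ∪ outerBoundary G D → z ∈ edgeClass G x := by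
        intro z hz hzb
        have hz' : z ∈ q.support := by simpa using hz
        exact hF z hzb ⟨q.takeUntil z hz'⟩
      refine ⟨⟨D, _, q.mapLe hle⟩, ⟨hD, ?_, ?_, hM _ (le_max_right _ _), ?_⟩, ?_⟩
      · intro z hz
        rcases union_outerBoundary_mono (G := G) (E := C) (fun w hw => hw.1.1) hz with h | h
        · exact h
        · exact absurd (hDA z hz) (hEA z (Or.inl (Or.inr h)))
      · exact fun h => hEA x (Or.inr rfl) (hDA x h)
      · exact fun z hz hzb => hq z hz (Or.inr hzb)
      · refine fun a ha => ⟨fun z hz => ?_, fun z hz hzb => ?_, fun z hz hzb => ?_⟩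
        · have hsub : D ⊆ a.1 := fun w hw => Set.mem_iInter₂.1 hw.1.2 a ha
          rcases union_outerBoundary_mono (G := G) hsub hz with h | h
          · exact h
          · exact absurd (hDA z hz) (hEA z (Or.inl (Or.inl (Or.inl
              (Set.mem_biUnion (Finset.mem_coe.2 ha) h)))))
        · exact hEA z (Or.inl (Or.inl (Or.inr (Set.mem_biUnion (Finset.mem_coe.2 ha) hz))))
            (hDA z (Or.inr hzb))
        · exact hq z hz (Or.inl (Set.mem_biUnion (Finset.mem_coe.2 ha) hzb)))
  refine ⟨fun n => (f n).1, fun n => (f n).2.1, fun n => (f n).2.2, fun n => (hf n).1.1,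
    fun n => (hf n).2.1, fun n => (hf n).2.2.1, fun n => (hf n).2.2.2.1,
    fun m n h => (hrel m n h).1, fun m n z hz hzb => ?_⟩
  rcases lt_trichotomy m n with h | rfl | h
  · exact (hrel m n h).2.2 z hz hzb
  · exact (hf m).2.2.2.2 z hz hzb
  · exact absurd hzb ((hrel n m h).2.1 z hz)

theorem dist_add_dist_of_mem_support {H : SimpleGraph V} {a b z : V} (p : H.Walk a b)
    (hp : p.length = H.dist a b) (hz : z ∈ p.support) :
    H.dist a z + H.dist z b = H.dist a b := by
  classical
  have h1 := congrArg Walk.length (p.take_spec hz)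
  rw [Walk.length_append, hp] at h1
  have h2 := dist_le (p.takeUntil z hz)
  have h3 := dist_le (p.dropUntil z hz)
  have h4 := (p.takeUntil z hz).reachable.dist_triangle_left b
  omega

/-- Consecutive geodesic jumps concatenate to a ray through all the stops. -/
theorem exists_ray_of_dist_add {G H : SimpleGraph V} (hle : H ≤ G) (u : ℕ → V)
    (hreach : ∀ i, H.Reachable (u 0) (u i)) (hne : ∀ i, u i ≠ u (i + 1))
    (hdist : ∀ i, H.dist (u 0) (u (i + 1)) = H.dist (u 0) (u i) + H.dist (u i) (u (i + 1))) :
    ∃ t : GraphRay G, t.f 0 = u 0 ∧ ∃ d : ℕ → ℕ, StrictMono d ∧ ∀ i, t.f (d i) = u i := by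
  have hstep : ∀ i, ∃ g : H.Walk (u i) (u (i + 1)), g.length = H.dist (u i) (u (i + 1)) :=
    fun i => ((hreach i).symm.trans (hreach (i + 1))).exists_walk_length_eq_dist
  choose g hg using hstep
  let W : ∀ i, H.Walk (u 0) (u i) := fun i => Nat.rec .nil (fun i w => w.append (g i)) i
  have hWs : ∀ i, W (i + 1) = (W i).append (g i) := fun i => rfl
  have hWlen : ∀ i, (W i).length = H.dist (u 0) (u i) := by
    intro i
    induction i with
    | zero => simp [W]
    | succ i ih => rw [hWs, Walk.length_append, ih, hg, hdist]
  have hmono : StrictMono fun i => (W i).length := by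
    refine strictMono_nat_of_lt_succ fun i => ?_
    have : 0 < H.dist (u i) (u (i + 1)) :=
      ((hreach i).symm.trans (hreach (i + 1))).pos_dist_of_ne (hne i)
    simp only [hWs, Walk.length_append, hg]
    omega
  have hcons : ∀ i k n, n ≤ (W i).length → (W (i + k)).getVert n = (W i).getVert n := by
    intro i k n hn
    induction k with
    | zero => rfl
    | succ k ih =>
      rw [← ih, ← Nat.add_assoc, hWs, Walk.getVert_append]
      have hle' := hmono.monotone (Nat.le_add_right i k)
      split_ifs with h
      · rfl
      · have heq : n = (W (i + k)).length := by omega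
        subst heq
        simp
  have hcons' : ∀ i j n, i ≤ j → n ≤ (W i).length → (W j).getVert n = (W i).getVert n := by
    intro i j n hij hn
    obtain ⟨k, rfl⟩ := Nat.exists_eq_add_of_le hij
    exact hcons i k n hn
  have hid : ∀ i, i ≤ (W i).length := hmono.id_le
  refine ⟨⟨fun n => (W n).getVert n, ?_, ?_⟩, rfl, fun i => (W i).length, hmono, fun i => ?_⟩
  · intro m n hmn
    have hp := (W (max m n)).isPath_of_length_eq_dist (hWlen _)
    have h := hid (max m n)
    refine hp.getVert_injOn (le_trans (le_max_left m n) h) (le_trans (le_max_right m n) h) ?_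
    rw [hcons' m _ m (le_max_left _ _) (hid m), hcons' n _ n (le_max_right _ _) (hid n)]
    exact hmn
  · intro n
    rw [← hcons' n (n + 1) n (Nat.le_succ n) (hid n)]
    exact hle ((W (n + 1)).adj_getVert_succ (hid (n + 1)))
  · exact (hcons' i _ _ (hid i) le_rfl).trans (W i).getVert_length

/-- In nested regions, a ray meeting infinitely many boundaries is not dominated. -/
theorem not_dominated_of_nested {G : SimpleGraph V} {D : ℕ → Set V} {x : V}
    (hfin : ∀ n, (outerBoundary G (D n)).Finite)
    (hnest : ∀ m n, m < n → D n ∪ outerBoundary G (D n) ⊆ D m)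
    (hout : ∀ v, G.Reachable x v → ∃ m, v ∉ D m ∪ outerBoundary G (D m))
    (t : GraphRay G) (ht : t.f 0 = x)
    (hinf : {n | ∃ m, t.f n ∈ outerBoundary G (D m)}.Infinite) : ¬ ∃ w, Dominates G w t := by
  rintro ⟨w, k, hk, P, -, hdisj⟩
  have htreach : ∀ n, G.Reachable x (t.f n) := by
    intro n
    induction n with
    | zero => rw [ht]
    | succ n ih => exact ih.trans (t.adj n).reachable
  obtain ⟨m, hm⟩ := hout w ((htreach (k 0)).trans (P 0).reachable.symm)
  obtain ⟨M, hM⟩ := t.exists_forall_notMem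
    (Set.Finite.biUnion (Set.finite_Iic m) fun i _ => hfin i)
  have hM' : ∀ n ≥ M, ∀ i ≤ m, t.f n ∉ outerBoundary G (D i) := fun n hn i hi h =>
    hM n hn (Set.mem_biUnion (Set.mem_Iic.2 hi) h)
  obtain ⟨n₀, ⟨j, hj⟩, hn₀⟩ := hinf.exists_gt M
  have hn₀D : t.f n₀ ∈ D m := by
    have hmj : m < j := by
      by_contra! h
      exact hM' n₀ hn₀.le j h hj
    exact hnest m j hmj (Or.inr hj)
  have htail : ∀ n ≥ n₀, t.f n ∈ D m := by
    intro n hn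
    induction n, hn using Nat.le_induction with
    | base => exact hn₀D
    | succ n hn ih =>
      by_contra h
      exact hM' (n + 1) (by omega) m le_rfl ⟨h, _, ih, (t.adj n).symm⟩
  have hz : ∀ i, ∃ z ∈ (P (n₀ + i)).support, z ∈ outerBoundary G (D m) := fun i =>
    exists_mem_support_outerBoundary le_rfl _ (fun h => hm (Or.inl h))
      (htail _ (le_trans (Nat.le_add_right _ _) (hk.id_le _)))
  choose z hzP hzB using hz
  refine Set.infinite_of_injective_forall_mem (f := z) ?_ hzB (hfin m)
  intro i j hij
  by_contra hne
  have := hdisj (n₀ + i) (n₀ + j) (by omega) (z i) (hzP i) (hij ▸ hzP j)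
  exact hm (Or.inr (this ▸ hzB i))

/-- If `x` edge-dominates a non-dominated ray with a tail in a region `C`, then some non-dominated
ray passes infinitely often through vertices of `C` in the edge-class of `x`. -/
theorem exists_ray_through_edgeClass {G : SimpleGraph V} {r : GraphRay G}
    (hr : ¬ ∃ w, Dominates G w r) {x : V} (hx : EdgeDominates G x r) {C : Set V}
    (hC : IsRayRegion G r C) :
    ∃ t : GraphRay G, (¬ ∃ w, Dominates G w t) ∧
      {n | t.f n ∈ edgeClass G x ∧ t.f n ∈ C}.Infinite := by
  classical
  obtain ⟨D, y, p, hfin, hsubC, hxD, hyD, hnest, hp⟩ := exists_nested_regions hr hx hC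
  have hout : ∀ v, G.Reachable x v → ∃ m, v ∉ D m ∪ outerBoundary G (D m) := by
    intro v hv
    rw [reachable_iff_reflTransGen] at hv
    induction hv with
    | refl => exact ⟨0, hxD 0⟩
    | @tail b c _ hbc ih =>
      obtain ⟨m, hm⟩ := ih
      refine ⟨m + 1, fun hmem => hm ?_⟩
      have hc := hnest m (m + 1) (Nat.lt_succ_self m) hmem
      by_cases hb : b ∈ D m
      · exact Or.inl hb
      · exact Or.inr ⟨hb, _, hc, hbc⟩
  let H : SimpleGraph V := fromEdgeSet {e | ∃ n, e ∈ (p n).edges}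
  have hHadj : ∀ {a b}, H.Adj a b → ∃ n, s(a, b) ∈ (p n).edges := fun h =>
    ((fromEdgeSet_adj _).1 h).1
  have hle : H ≤ G := fun a b h => by
    obtain ⟨n, hn⟩ := hHadj h
    exact (p n).adj_of_mem_edges hn
  have hHy : ∀ n, H.Reachable x (y n) := fun n => by
    refine ⟨(p n).transfer H fun e he => ?_⟩
    have hG := (p n).edges_subset_edgeSet he
    rw [edgeSet_fromEdgeSet]
    exact ⟨⟨n, he⟩, G.not_isDiag_of_mem_edgeSet hG⟩
  have hHclass : ∀ u, H.Reachable x u → ∀ m, u ∈ outerBoundary G (D m) → u ∈ edgeClass G x := by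
    intro u hu m hum
    rw [reachable_iff_reflTransGen] at hu
    rcases hu.cases_tail with rfl | ⟨a, -, hau⟩
    · exact absurd (Or.inr hum) (hxD m)
    · obtain ⟨n, hn⟩ := hHadj hau
      exact hp m n u ((p n).snd_mem_support_of_mem_edges hn) hum
  let Good : V → Prop := fun v => H.Reachable x v ∧
    {n | H.dist x v + H.dist v (y n) = H.dist x (y n)}.Infinite
  have hstep : ∀ v : {v // Good v}, ∃ u : {v // Good v}, v.1 ≠ u.1 ∧
      H.dist x u.1 = H.dist x v.1 + H.dist v.1 u.1 ∧ ∃ m, u.1 ∈ outerBoundary G (D m) := by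
    rintro ⟨v, hv, hvinf⟩
    obtain ⟨m, hm⟩ := hout v (hv.mono hle)
    have hcross : ∀ n > m, ∃ u ∈ outerBoundary G (D m), H.Reachable v u ∧
        H.dist v u + H.dist u (y n) = H.dist v (y n) := by
      intro n hn
      obtain ⟨q, hq⟩ := (hv.symm.trans (hHy n)).exists_walk_length_eq_dist
      obtain ⟨u, huq, hu⟩ := exists_mem_support_outerBoundary hle q (fun h => hm (Or.inl h))
        (hnest m n hn (Or.inl (hyD n)))
      exact ⟨u, hu, ⟨q.takeUntil u huq⟩, dist_add_dist_of_mem_support q hq huq⟩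
    obtain ⟨u, hu, huinf⟩ : ∃ u ∈ outerBoundary G (D m), {n | H.Reachable v u ∧
        H.dist v u + H.dist u (y n) = H.dist v (y n) ∧
        H.dist x v + H.dist v (y n) = H.dist x (y n)}.Infinite := by
      by_contra! hcon
      refine hvinf (((Set.finite_Iic m).union ((hfin m).biUnion fun u hu =>
        hcon u hu)).subset fun n hn => ?_)
      rcases le_or_gt n m with h | h
      · exact Or.inl h
      · obtain ⟨u, hu, hvu, hd⟩ := hcross n h
        exact Or.inr (Set.mem_biUnion hu ⟨hvu, hd, hn⟩)
    have hvu : H.Reachable v u := huinf.nonempty.some_mem.1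
    have hdist : ∀ n, H.dist v u + H.dist u (y n) = H.dist v (y n) →
        H.dist x v + H.dist v (y n) = H.dist x (y n) → H.dist x u = H.dist x v + H.dist v u := by
      intro n h1 h2
      have h3 := hv.dist_triangle_left u
      have h4 := (hv.trans hvu).dist_triangle_left (y n)
      omega
    refine ⟨⟨u, hv.trans hvu, huinf.mono ?_⟩, ?_, ?_, m, hu⟩
    · rintro n ⟨-, h1, h2⟩
      have := hdist n h1 h2
      simp only [Set.mem_ofPred_eq]
      omega
    · rintro rfl
      exact hm (Or.inr hu)
    · obtain ⟨n, -, h1, h2⟩ := huinf.nonempty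
      exact hdist n h1 h2
  choose next hnext using hstep
  have hx0 : Good x := ⟨.refl x, by simpa using Set.infinite_univ⟩
  let u : ℕ → {v // Good v} := fun i => next^[i] ⟨x, hx0⟩
  have hu : ∀ i, u (i + 1) = next (u i) := fun i => Function.iterate_succ_apply' next i _
  obtain ⟨t, ht0, d, hd, htd⟩ := exists_ray_of_dist_add hle (fun i => (u i).1)
    (fun i => (u i).2.1) (fun i => by simpa only [hu] using (hnext (u i)).1)
    (fun i => by
      rw [hu]
      exact (hnext (u i)).2.1)
  have hbd : ∀ i, ∃ m, t.f (d (i + 1)) ∈ outerBoundary G (D m) := fun i => by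
    rw [htd, hu]
    exact (hnext (u i)).2.2
  have hd' : Function.Injective fun i => d (i + 1) := hd.injective.comp (add_left_injective 1)
  refine ⟨t, not_dominated_of_nested hfin hnest hout t ht0
    (Set.infinite_of_injective_forall_mem hd' hbd),
    Set.infinite_of_injective_forall_mem hd' fun i => ?_⟩
  obtain ⟨m, hm⟩ := hbd i
  refine ⟨hHclass _ ?_ m hm, hsubC m (Or.inr hm)⟩
  rw [htd]
  exact (u (i + 1)).2.1

theorem exists_edgeDominates_of_separated {G : SimpleGraph V} {r s : GraphRay G}
    (hrs : RayEdgeEquiv G r s) {D : Set V} (hD : IsRayRegion G r D) {M : ℕ}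
    (hs : ∀ n ≥ M, s.f n ∉ D) : ∃ x, EdgeDominates G x r ∧ EdgeDominates G x s := by
  classical
  suffices h : ∃ x, EdgeDominates G x r by
    obtain ⟨x, hx⟩ := h
    refine ⟨x, hx, fun F => ?_⟩
    obtain ⟨N, hN⟩ := hx F
    obtain ⟨K, hK⟩ := hrs F
    exact ⟨K, fun n hn => (hN (max N K) (le_max_left _ _)).trans (hK _ (le_max_right _ _) n hn)⟩
  by_contra! hcon
  simp only [EdgeDominates] at hcon
  push Not at hcon
  choose F hF using hcon
  obtain ⟨hfin, N, hN⟩ := hD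
  obtain ⟨K, hK⟩ := hrs (hfin.toFinset.biUnion F)
  obtain ⟨q⟩ := (hK (max N K) (le_max_right _ _) (max M K) (le_max_right _ _)).symm
  obtain ⟨z, hzq, hz⟩ := exists_mem_support_outerBoundary (deleteEdges_le _) q
    (hs _ (le_max_left _ _)) (hN _ (le_max_left _ _))
  obtain ⟨n, hn, hnz⟩ := hF z K
  have hreach : (G.deleteEdges ↑(hfin.toFinset.biUnion F)).Reachable z (r.f n) :=
    (Walk.reachable (q.dropUntil z hzq)).trans ((hK _ (le_max_right _ _) _ (le_max_right M K)).trans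
      (hK n hn _ (le_max_right M K)).symm)
  refine hnz (hreach.mono (deleteEdges_anti ?_))
  exact_mod_cast Finset.subset_biUnion_of_mem F (hfin.mem_toFinset.2 hz)

/-- The vertices of `G` in a component of `G - X`. -/
def componentCarrier {G : SimpleGraph V} {X : Set V}
    (C : (G.induce Xᶜ).ConnectedComponent) : Set V :=
  {v | ∃ hv : v ∈ Xᶜ, (G.induce Xᶜ).connectedComponentMk ⟨v, hv⟩ = C}

theorem outerBoundary_componentCarrier_subset {G : SimpleGraph V} {X : Set V}
    (C : (G.induce Xᶜ).ConnectedComponent) : outerBoundary G (componentCarrier C) ⊆ X := by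
  rintro w ⟨hw, z, ⟨hz, rfl⟩, hwz⟩
  by_contra hX
  refine hw ⟨hX, ConnectedComponent.sound (Adj.reachable ?_)⟩
  exact hwz

theorem GraphRay.exists_isRayRegion_componentCarrier {G : SimpleGraph V} (r : GraphRay G)
    {X : Set V} (hX : X.Finite) :
    ∃ C : (G.induce Xᶜ).ConnectedComponent, IsRayRegion G r (componentCarrier C) := by
  obtain ⟨N, hN⟩ := r.exists_forall_notMem hX
  refine ⟨(G.induce Xᶜ).connectedComponentMk ⟨r.f N, hN N le_rfl⟩,
    hX.subset (outerBoundary_componentCarrier_subset _), N, fun n hn => ?_⟩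
  induction n, hn using Nat.le_induction with
  | base => exact ⟨hN N le_rfl, rfl⟩
  | succ n hn ih =>
    by_contra h
    exact hN (n + 1) (by omega)
      (outerBoundary_componentCarrier_subset _ ⟨h, _, ih, (r.adj n).symm⟩)

/-- If for every finite vertex set `F` and vertex `v` at most one component `C`
of `G - F` is such that `edgeClass v ∩ C` contains a non-dominated ray, then any
two edge-equivalent non-dominated rays are vertex-equivalent. -/
theorem end_correlated_of_unique_component {V : Type*} [Infinite V] (G : SimpleGraph V)
    (h : ∀ (F : Finset V) (v : V)
      (C C' : (G.induce ((↑F : Set V)ᶜ)).ConnectedComponent),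
      (∃ t : GraphRay G, (¬ ∃ w, Dominates G w t) ∧
        {n : ℕ | t.f n ∈ edgeClass G v ∧
          ∃ hn : t.f n ∈ ((↑F : Set V)ᶜ),
            (G.induce ((↑F : Set V)ᶜ)).connectedComponentMk ⟨t.f n, hn⟩ = C}.Infinite) →
      (∃ t : GraphRay G, (¬ ∃ w, Dominates G w t) ∧
        {n : ℕ | t.f n ∈ edgeClass G v ∧
          ∃ hn : t.f n ∈ ((↑F : Set V)ᶜ),
            (G.induce ((↑F : Set V)ᶜ)).connectedComponentMk ⟨t.f n, hn⟩ = C'}.Infinite) →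
      C = C') :
    ∀ r s : GraphRay G, RayEdgeEquiv G r s →
      (¬ ∃ w, Dominates G w r) → (¬ ∃ w, Dominates G w s) →
      RayVertexEquiv G r s := by
  intro r s hrs hr hs X
  obtain ⟨C, hC⟩ := r.exists_isRayRegion_componentCarrier X.finite_toSet
  obtain ⟨C', hC'⟩ := s.exists_isRayRegion_componentCarrier X.finite_toSet
  obtain ⟨N, hN⟩ := hC.2
  obtain ⟨N', hN'⟩ := hC'.2
  have hCC : C = C' := by
    by_contra hne
    obtain ⟨x, hxr, hxs⟩ := exists_edgeDominates_of_separated hrs hC (M := N') (by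
      rintro n hn ⟨_, h1⟩
      obtain ⟨_, h2⟩ := hN' n hn
      exact hne (h1.symm.trans h2))
    exact hne (h X x C C' (exists_ray_through_edgeClass hr hxr hC)
      (exists_ray_through_edgeClass hs hxs hC'))
  subst hCC
  refine ⟨max N N', fun m hm n hn => ?_⟩
  obtain ⟨hm', h1⟩ := hN m (le_trans (le_max_left _ _) hm)
  obtain ⟨hn', h2⟩ := hN' n (le_trans (le_max_right _ _) hn)
  exact ⟨hm', hn', ConnectedComponent.exact (h1.trans h2.symm)⟩
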